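/- Let x ∈ M be of rank 1, 2, or 3. Then: if rank(x) = 1 there exists g ∈ G(M) with g(x) = (1, 0, 0, 0); if rank(x) = 2 there exists g ∈ G(M) with g(x) = (1, 0, diag(1,0,0), 0); if rank(x) = 3 there exists g ∈ G(M) with g(x) = (1, 0, diag(1,1,0), 0). In particular G(M) acts transitively on the set of elements of rank 1, on the set of elements of rank 2, and on the set of elements of rank 3. -/

import Mathlib

open Matrix

namespace Freudenthal

variable (F : Type*) [Field F]

/-- The cubic Jordan algebra `J = M₃(F)`. -/
abbrev Mat := Matrix (Fin 3) (Fin 3) F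

/-- The trace bilinear form `(A, B) = tr(A·B)` on `J`. -/
def tb (A B : Mat F) : F := (A * B).trace

/-- The Freudenthal cross product `A × B = (A+B)# − A# − B#` (adjoint = adjugate). -/
def cross (A B : Mat F) : Mat F := (A + B).adjugate - A.adjugate - B.adjugate

/-- The Freudenthal module `M = F ⊕ F ⊕ J ⊕ J`, elements `(α, β, A, B)`. -/
abbrev FM := F × F × Mat F × Mat F

/-- The quartic norm `q(x) = 8(A#,B#) − 8α·det A − 8β·det B − 2((A,B) − αβ)²`. -/
def qf (x : FM F) : F :=
  8 * tb F x.2.2.1.adjugate x.2.2.2.adjugate - 8 * x.1 * x.2.2.1.det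
    - 8 * x.2.1 * x.2.2.2.det - 2 * (tb F x.2.2.1 x.2.2.2 - x.1 * x.2.1) ^ 2

/-- The symplectic form `{x, y} = αδ − βγ + (A,D) − (B,C)`. -/
def symp (x y : FM F) : F :=
  x.1 * y.2.1 - x.2.1 * y.1 + tb F x.2.2.1 y.2.2.2 - tb F x.2.2.2 y.2.2.1

/-- Membership in the group `G(M)`: invertible `F`-linear transformations of `M`
preserving the quartic norm `q` and the symplectic form `{·,·}`. -/
def InG (g : FM F → FM F) : Prop :=
  IsLinearMap F g ∧ Function.Bijective g ∧
    (∀ x, qf F (g x) = qf F x) ∧ (∀ x y, symp F (g x) (g y) = symp F x y)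

/-- The trilinear cube `T(x,x,x)`. -/
def Tcube (x : FM F) : FM F :=
  (-(x.1 ^ 2 * x.2.1) + x.1 * tb F x.2.2.1 x.2.2.2 - 2 * x.2.2.2.det,
   x.1 * x.2.1 ^ 2 - x.2.1 * tb F x.2.2.1 x.2.2.2 + 2 * x.2.2.1.det,
   (2 : F) • cross F x.2.2.2 x.2.2.1.adjugate - (2 * x.2.1) • x.2.2.2.adjugate
     - (tb F x.2.2.1 x.2.2.2 - x.1 * x.2.1) • x.2.2.1,
   -((2 : F) • cross F x.2.2.1 x.2.2.2.adjugate) + (2 * x.1) • x.2.2.1.adjugate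
     + (tb F x.2.2.1 x.2.2.2 - x.1 * x.2.1) • x.2.2.2)

/-- The rank `≤ 1` condition: `αA − B# = 0`, `βB − A# = 0`, and
`(αβ − (A,B))C + ABC + CBA = 0` for all `C ∈ J`. -/
def RankLeOne (x : FM F) : Prop :=
  x.1 • x.2.2.1 - x.2.2.2.adjugate = 0 ∧
  x.2.1 • x.2.2.2 - x.2.2.1.adjugate = 0 ∧
  ∀ C : Mat F,
    (x.1 * x.2.1 - tb F x.2.2.1 x.2.2.2) • C
      + x.2.2.1 * x.2.2.2 * C + C * x.2.2.2 * x.2.2.1 = 0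

/-- `x` has rank `1`. -/
def RankOne (x : FM F) : Prop := x ≠ 0 ∧ RankLeOne F x

/-- `x` has rank `2`: `T(x,x,x) = 0` but the rank `≤ 1` condition fails. -/
def RankTwo (x : FM F) : Prop := Tcube F x = 0 ∧ ¬ RankLeOne F x

/-- `x` has rank `3`: `q(x) = 0` but `T(x,x,x) ≠ 0`. -/
def RankThree (x : FM F) : Prop := qf F x = 0 ∧ Tcube F x ≠ 0

end Freudenthal

namespace Freudenthal

variable {F : Type*} [Field F]

theorem tb_eq (A B : Mat F) : tb F A B =
    A 0 0 * B 0 0 + A 0 1 * B 1 0 + A 0 2 * B 2 0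
    + (A 1 0 * B 0 1 + A 1 1 * B 1 1 + A 1 2 * B 2 1)
    + (A 2 0 * B 0 2 + A 2 1 * B 1 2 + A 2 2 * B 2 2) := by
  simp [tb, Matrix.trace_fin_three, Matrix.mul_apply, Fin.sum_univ_three]

theorem adj_add (A B : Mat F) : (A + B).adjugate = A.adjugate + cross F A B + B.adjugate := by
  unfold cross; abel

theorem cross_eq (A B : Mat F) : cross F A B = !![
    A 1 1 * B 2 2 + B 1 1 * A 2 2 - A 1 2 * B 2 1 - B 1 2 * A 2 1,
    A 0 2 * B 2 1 + B 0 2 * A 2 1 - A 0 1 * B 2 2 - B 0 1 * A 2 2,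
    A 0 1 * B 1 2 + B 0 1 * A 1 2 - A 0 2 * B 1 1 - B 0 2 * A 1 1;
    A 1 2 * B 2 0 + B 1 2 * A 2 0 - A 1 0 * B 2 2 - B 1 0 * A 2 2,
    A 0 0 * B 2 2 + B 0 0 * A 2 2 - A 0 2 * B 2 0 - B 0 2 * A 2 0,
    A 0 2 * B 1 0 + B 0 2 * A 1 0 - A 0 0 * B 1 2 - B 0 0 * A 1 2;
    A 1 0 * B 2 1 + B 1 0 * A 2 1 - A 1 1 * B 2 0 - B 1 1 * A 2 0,
    A 0 1 * B 2 0 + B 0 1 * A 2 0 - A 0 0 * B 2 1 - B 0 0 * A 2 1,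
    A 0 0 * B 1 1 + B 0 0 * A 1 1 - A 0 1 * B 1 0 - B 0 1 * A 1 0] := by
  ext i j
  fin_cases i <;> fin_cases j <;> simp [cross, Matrix.adjugate_fin_three] <;> ring

theorem symp_nondeg (x : FM F) (h : ∀ y, symp F x y = 0) : x = 0 := by
  obtain ⟨a, b, A, B⟩ := x
  have ha := h (0, 1, 0, 0)
  have hb := h (1, 0, 0, 0)
  have hA : ∀ i j, A i j = 0 := by
    intro i j
    have := h (0, 0, 0, Matrix.single j i 1)
    fin_cases i <;> fin_cases j <;> simpa [symp, tb_eq] using this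
  have hB : ∀ i j, B i j = 0 := by
    intro i j
    have := h (0, 0, Matrix.single j i 1, 0)
    fin_cases i <;> fin_cases j <;> simpa [symp, tb_eq] using this
  simp [symp, tb_eq] at ha hb
  have e1 : A = 0 := by ext i j; simp [hA]
  have e2 : B = 0 := by ext i j; simp [hB]
  subst ha hb e1 e2; rfl

theorem symp_sub (x x' y : FM F) : symp F (x - x') y = symp F x y - symp F x' y := by
  simp [symp, tb_eq]; ring

theorem InG.mk' (g : FM F → FM F) (hl : IsLinearMap F g) (hq : ∀ x, qf F (g x) = qf F x)
    (hs : ∀ x y, symp F (g x) (g y) = symp F x y) : InG F g := by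
  refine ⟨hl, ?_, hq, hs⟩
  have hinj : Function.Injective (IsLinearMap.mk' g hl) := by
    intro x y hxy
    have hxy' : g x = g y := hxy
    rw [← sub_eq_zero]
    apply symp_nondeg
    intro z
    rw [symp_sub, ← hs x, ← hs y, hxy', sub_self]
  exact ⟨hinj, LinearMap.injective_iff_surjective.1 hinj⟩

theorem InG.comp {g h : FM F → FM F} (hg : InG F g) (hh : InG F h) : InG F (fun x => g (h x)) := by
  refine ⟨⟨fun x y => ?_, fun c x => ?_⟩, hg.2.1.comp hh.2.1, fun x => ?_, fun x y => ?_⟩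
  · rw [hh.1.map_add, hg.1.map_add]
  · rw [hh.1.map_smul, hg.1.map_smul]
  · rw [hg.2.2.1, hh.2.2.1]
  · rw [hg.2.2.2, hh.2.2.2]

theorem InG.inv {g : FM F → FM F} (hg : InG F g) : ∃ h, InG F h ∧ ∀ x, h (g x) = x := by
  let e := Equiv.ofBijective g hg.2.1
  have he : ∀ x, g (e.symm x) = x := fun x => e.apply_symm_apply x
  refine ⟨e.symm, ⟨⟨fun x y => ?_, fun c x => ?_⟩, e.symm.bijective, fun x => ?_, fun x y => ?_⟩,
    fun x => e.symm_apply_apply x⟩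
  · apply hg.2.1.1; rw [hg.1.map_add, he, he, he]
  · apply hg.2.1.1; rw [hg.1.map_smul, he, he]
  · rw [← hg.2.2.1, he]
  · rw [← hg.2.2.2, he, he]

/-- being in the same orbit -/
def Orb (x y : FM F) : Prop := ∃ g : FM F → FM F, InG F g ∧ g x = y

theorem Orb.trans {x y z : FM F} (h : Orb x y) (h' : Orb y z) : Orb x z := by
  obtain ⟨g, hg, rfl⟩ := h
  obtain ⟨g', hg', rfl⟩ := h'
  exact ⟨_, hg'.comp hg, rfl⟩

theorem Orb.symm {x y : FM F} (h : Orb x y) : Orb y x := by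
  obtain ⟨g, hg, rfl⟩ := h
  obtain ⟨g', hg', h'⟩ := hg.inv
  exact ⟨_, hg', h' x⟩

theorem orb_swap (a b : F) (A B : Mat F) : Orb (a, b, A, B) (-b, a, -B, A) := by
  refine ⟨fun x => (-x.2.1, x.1, -x.2.2.2, x.2.2.1), InG.mk' _ ⟨?_, ?_⟩ ?_ ?_, rfl⟩
  · intro x y; simp; constructor
    · ring
    · abel
  · intro c x; simp
  · rintro ⟨a, b, A, B⟩
    simp only [qf, tb_eq, Matrix.det_fin_three, Matrix.adjugate_fin_three]
    simp
    ring
  · rintro ⟨a, b, A, B⟩ ⟨c, d, C, D⟩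
    simp [symp, tb_eq]
    ring

theorem orb_levi (P P' Q Q' : Mat F) (l m : F) (hP : P * P' = 1) (hQ : Q * Q' = 1)
    (hl : P.det * Q.det = l) (hm : m * l = 1) (a b : F) (A B : Mat F) :
    Orb (a, b, A, B) (m * a, l * b, P * A * Q, Q' * B * P') := by
  have hP' := mul_eq_one_comm.1 hP
  have hQ' := mul_eq_one_comm.1 hQ
  have key : ∀ X Y : Mat F, tb F (P * X * Q) (Q' * Y * P') = tb F X Y := by
    intro X Y
    unfold tb
    rw [show P * X * Q * (Q' * Y * P') = P * (X * Y) * P' by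
      rw [show P * X * Q * (Q' * Y * P') = P * X * (Q * Q') * Y * P' by simp only [Matrix.mul_assoc],
        hQ]; simp only [Matrix.mul_assoc, Matrix.mul_one, Matrix.one_mul], Matrix.trace_mul_comm,
        ← Matrix.mul_assoc, hP', Matrix.one_mul]
  have keyB : ∀ X Y : Mat F, tb F (Q' * X * P') (P * Y * Q) = tb F X Y := by
    intro X Y
    have := key Y X
    unfold tb at *
    rw [Matrix.trace_mul_comm, this, Matrix.trace_mul_comm]
  have hPd : P.det * P'.det = 1 := by rw [← Matrix.det_mul, hP, Matrix.det_one]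
  have hQd : Q.det * Q'.det = 1 := by rw [← Matrix.det_mul, hQ, Matrix.det_one]
  have adjP : P.adjugate * P'.adjugate = 1 := by
    rw [← Matrix.adjugate_mul_distrib, hP', Matrix.adjugate_one]
  have adjQ : Q'.adjugate * Q.adjugate = 1 := by
    rw [← Matrix.adjugate_mul_distrib, hQ, Matrix.adjugate_one]
  have key2 : ∀ X Y : Mat F, tb F (P * X * Q).adjugate (Q' * Y * P').adjugate
      = tb F X.adjugate Y.adjugate := by
    intro X Y
    unfold tb
    simp only [Matrix.adjugate_mul_distrib]
    rw [show Q.adjugate * (X.adjugate * P.adjugate) * (P'.adjugate * (Y.adjugate * Q'.adjugate))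
      = Q.adjugate * X.adjugate * (P.adjugate * P'.adjugate) * Y.adjugate * Q'.adjugate by
        simp only [Matrix.mul_assoc], adjP, Matrix.trace_mul_comm]
    simp only [← Matrix.mul_assoc]
    rw [adjQ]; simp
  refine ⟨fun x => (m * x.1, l * x.2.1, P * x.2.2.1 * Q, Q' * x.2.2.2 * P'),
    InG.mk' _ ⟨?_, ?_⟩ ?_ ?_, rfl⟩
  · intro x y; simp [Matrix.mul_add, Matrix.add_mul, mul_add]
  · intro c x; simp [mul_left_comm]
  · rintro ⟨a, b, A, B⟩
    simp only [qf, key, key2, Matrix.det_mul]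
    have e1 : m * (P.det * Q.det) = 1 := by rw [hl, hm]
    have e2 : l * (Q'.det * P'.det) = 1 := by
      rw [← hl]; linear_combination P.det * P'.det * hQd + hPd
    linear_combination (-8 * a * A.det) * e1 - 8 * b * B.det * e2
      - 2 * (-a*b* (2 * tb F A B - a * b - m * l * a * b)) * hm
  · rintro ⟨a, b, A, B⟩ ⟨c, d, C, D⟩
    simp only [symp, key, keyB]
    linear_combination (a*d-b*c) * hm

end Freudenthal
namespace Freudenthal
variable {F : Type*} [Field F]

/-- The unipotent transformation attached to `C`. -/
def phi (C : Mat F) (x : FM F) : FM F :=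
  (x.1 + tb F x.2.2.2 C + tb F x.2.2.1 C.adjugate + x.2.1 * C.det, x.2.1,
    x.2.2.1 + x.2.1 • C, x.2.2.2 + cross F x.2.2.1 C + x.2.1 • C.adjugate)

theorem phi_add (C C' : Mat F) (x : FM F) : phi (C + C') x = phi C (phi C' x) := by
  obtain ⟨a, b, A, B⟩ := x
  simp only [phi, Prod.mk.injEq]
  refine ⟨?_, trivial, ?_, ?_⟩
  · simp only [tb_eq, Matrix.det_fin_three, Matrix.adjugate_fin_three, cross_eq]
    simp
    ring
  · module
  · simp only [cross_eq, Matrix.adjugate_fin_three]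
    ext i j
    fin_cases i <;> fin_cases j <;> simp <;> ring

theorem phi_single_q (i j : Fin 3) (c : F) (x : FM F) :
    qf F (phi (Matrix.single i j c) x) = qf F x := by
  obtain ⟨a, b, A, B⟩ := x
  fin_cases i <;> fin_cases j <;>
  · simp only [qf, phi, tb_eq, Matrix.det_fin_three, Matrix.adjugate_fin_three, cross_eq]
    simp
    ring

theorem phi_symp (C : Mat F) (x y : FM F) : symp F (phi C x) (phi C y) = symp F x y := by
  obtain ⟨a, b, A, B⟩ := x
  obtain ⟨a', b', A', B'⟩ := y
  simp only [symp, phi, tb_eq, Matrix.det_fin_three, Matrix.adjugate_fin_three, cross_eq]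
  simp
  ring

theorem phi_q (C : Mat F) : ∀ x : FM F, qf F (phi C x) = qf F x := by
  induction C using Matrix.induction_on' with
  | h_zero => rintro ⟨a, b, A, B⟩; simp [phi, tb, cross]
  | h_add C C' h h' => intro x; rw [phi_add, h, h']
  | h_std_basis i j c => intro x; exact phi_single_q i j c x

theorem orb_phi (C : Mat F) (a b : F) (A B : Mat F) :
    Orb (a, b, A, B) (a + tb F B C + tb F A C.adjugate + b * C.det, b, A + b • C,
      B + cross F A C + b • C.adjugate) := by
  refine ⟨phi C, InG.mk' _ ⟨?_, ?_⟩ (phi_q C) (phi_symp C), rfl⟩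
  · rintro ⟨a, b, A, B⟩ ⟨a', b', A', B'⟩
    simp only [phi, Prod.mk_add_mk, Prod.mk.injEq]
    refine ⟨?_, trivial, ?_, ?_⟩
    · simp only [tb_eq, Matrix.add_apply]; ring
    · rw [add_smul]; abel
    · simp only [cross_eq, Matrix.adjugate_fin_three]
      ext i j
      fin_cases i <;> fin_cases j <;> simp <;> ring
  · rintro c ⟨a, b, A, B⟩
    simp only [phi, Prod.smul_mk, Prod.mk.injEq]
    refine ⟨?_, trivial, ?_, ?_⟩
    · simp only [tb_eq, Matrix.smul_apply, smul_eq_mul]; ring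
    · simp [smul_smul]
    · simp only [cross_eq, Matrix.adjugate_fin_three]
      ext i j
      fin_cases i <;> fin_cases j <;> simp <;> ring

end Freudenthal
namespace Freudenthal
variable {F : Type*} [Field F]

theorem det_add' (t : F) (A C : Mat F) : (A + t • C).det
    = A.det + t * tb F A.adjugate C + t ^ 2 * tb F A C.adjugate + t ^ 3 * C.det := by
  simp only [tb_eq, Matrix.det_fin_three, Matrix.adjugate_fin_three]
  simp
  ring

theorem adj_add' (t : F) (A C : Mat F) : (A + t • C).adjugate
    = A.adjugate + t • cross F A C + t ^ 2 • C.adjugate := by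
  rw [cross_eq]
  simp only [Matrix.adjugate_fin_three]
  ext i j
  fin_cases i <;> fin_cases j <;> simp <;> ring

theorem tb_add_left (A B C : Mat F) : tb F (A + B) C = tb F A C + tb F B C := by
  simp [tb, Matrix.add_mul]
theorem tb_add_right (A B C : Mat F) : tb F C (A + B) = tb F C A + tb F C B := by
  simp [tb, Matrix.mul_add]
theorem tb_sub_right (A B C : Mat F) : tb F C (A - B) = tb F C A - tb F C B := by
  simp [tb, Matrix.mul_sub]
theorem tb_sub_left (A B C : Mat F) : tb F (A - B) C = tb F A C - tb F B C := by
  simp [tb, Matrix.sub_mul]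
theorem tb_neg_left (A C : Mat F) : tb F (-A) C = - tb F A C := by
  simp [tb]
theorem tb_smul_left (t : F) (A C : Mat F) : tb F (t • A) C = t * tb F A C := by
  simp [tb]
theorem tb_smul_right (t : F) (A C : Mat F) : tb F C (t • A) = t * tb F C A := by
  simp [tb]

theorem tb_comm (X Y : Mat F) : tb F X Y = tb F Y X := by
  simp only [tb]; exact Matrix.trace_mul_comm X Y

theorem tb_cross (X B D : Mat F) : tb F X (cross F B D) = tb F (cross F B X) D := by
  simp only [tb_eq, cross_eq]
  simp
  ring

theorem tb_cross_cross (A B C D : Mat F) : tb F (cross F A C) (cross F B D)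
    = tb F A B * tb F C D + tb F A D * tb F B C - tb F D (A * B * C) - tb F D (C * B * A) := by
  simp only [tb_eq, cross_eq]
  simp [Matrix.mul_apply, Fin.sum_univ_three]
  ring

theorem qf_line (t a b c d : F) (A B C D : Mat F) :
    qf F ((a, b, A, B) + t • (c, d, C, D)) =
      8 * (tb F A.adjugate B.adjugate
        + t * (tb F (cross F B A.adjugate) D + tb F (cross F A B.adjugate) C)
        + t ^ 2 * (tb F A.adjugate D.adjugate + tb F B.adjugate C.adjugate
            + tb F (cross F A C) (cross F B D))
        + t ^ 3 * (tb F (cross F A C) D.adjugate + tb F C.adjugate (cross F B D))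
        + t ^ 4 * tb F C.adjugate D.adjugate)
      - 8 * (a + t * c) * (A.det + t * tb F A.adjugate C + t ^ 2 * tb F A C.adjugate + t ^ 3 * C.det)
      - 8 * (b + t * d) * (B.det + t * tb F B.adjugate D + t ^ 2 * tb F B D.adjugate + t ^ 3 * D.det)
      - 2 * (tb F A B + t * (tb F A D + tb F B C) + t ^ 2 * tb F C D
          - (a + t * c) * (b + t * d)) ^ 2 := by
  simp only [qf, Prod.smul_mk, Prod.mk_add_mk, det_add', adj_add', tb_add_left, tb_add_right,
    tb_smul_left, tb_smul_right, smul_eq_mul]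
  rw [tb_comm C B, tb_comm (cross F A C) B.adjugate, tb_comm C.adjugate B.adjugate,
    tb_cross B.adjugate A C, tb_cross A.adjugate B D]
  ring

theorem line_forms (x y : FM F) : x + y = x + (1 : F) • y ∧ x - y = x + (-1 : F) • y ∧
    x - (2 : F) • y = x + (-2 : F) • y ∧ x = x + (0 : F) • y ∧ y = 0 + (1 : F) • y := by
  refine ⟨?_, ?_, ?_, ?_, ?_⟩ <;> module

theorem T_polar (x y : FM F) :
    8 * (qf F (x + y) - qf F (x - y)) - (qf F (x + (2:F) • y) - qf F (x - (2:F) • y))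
      = 48 * symp F (Tcube F x) y := by
  obtain ⟨l1, l2, l3, -, -⟩ := line_forms x y
  rw [l1, l2, l3]
  obtain ⟨a, b, A, B⟩ := x
  obtain ⟨c, d, C, D⟩ := y
  simp only [qf_line, symp, Tcube, tb_add_left, tb_sub_left, tb_neg_left, tb_smul_left]
  ring

/-- intrinsic form of rank ≤ 1 -/
def Intr (x : FM F) : Prop := ∀ y, qf F (x + y) + qf F (x - y) - 2 * qf F x - 2 * qf F y
  = -4 * symp F x y ^ 2

theorem intr_polar (a b c d : F) (A B C D : Mat F) :
    qf F ((a,b,A,B) + (c,d,C,D)) + qf F ((a,b,A,B) - (c,d,C,D)) - 2 * qf F (a,b,A,B) -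
      2 * qf F (c,d,C,D) + 4 * symp F (a,b,A,B) (c,d,C,D) ^ 2
      = -16 * tb F C.adjugate (a • A - B.adjugate) - 16 * tb F D.adjugate (b • B - A.adjugate)
        + 16 * c * tb F (b • B - A.adjugate) C + 16 * d * tb F (a • A - B.adjugate) D
        + 8 * c * d * (tb F A B - 3 * (a * b))
        + tb F D ((8 * (tb F A B + a * b)) • C - (16 : F) • (A * B * C + C * B * A)) := by
  obtain ⟨l1, l2, -, -, -⟩ := line_forms (a, b, A, B) (c, d, C, D)
  rw [l1, l2]
  simp only [qf_line, tb_cross_cross, tb_sub_left, tb_sub_right, tb_smul_left, tb_smul_right,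
    tb_add_right]
  simp only [qf, symp]
  rw [tb_comm C.adjugate A, tb_comm C.adjugate B.adjugate, tb_comm D.adjugate B,
    tb_comm D.adjugate A.adjugate, tb_comm D C]
  ring

end Freudenthal
namespace Freudenthal
variable {F : Type*} [Field F]

theorem Orb.qf_eq {x y : FM F} (h : Orb x y) : qf F y = qf F x := by
  obtain ⟨g, hg, rfl⟩ := h
  exact hg.2.2.1 x

theorem Orb.intr {x y : FM F} (h : Orb x y) (hx : Intr x) : Intr y := by
  obtain ⟨g, hg, rfl⟩ := h
  intro z
  obtain ⟨w, rfl⟩ := hg.2.1.2 z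
  rw [← hg.1.map_add, ← hg.1.map_sub, hg.2.2.2]
  simp only [hg.2.2.1]
  exact hx w

theorem Orb.Tcube_zero (h2 : (2 : F) ≠ 0) (h3 : (3 : F) ≠ 0) {x y : FM F} (h : Orb x y)
    (hx : Tcube F x = 0) : Tcube F y = 0 := by
  obtain ⟨g, hg, rfl⟩ := h
  apply symp_nondeg
  intro z
  obtain ⟨w, rfl⟩ := hg.2.1.2 z
  have h1 := T_polar (g x) (g w)
  rw [← hg.1.map_smul, ← hg.1.map_add, ← hg.1.map_sub, ← hg.1.map_add, ← hg.1.map_sub] at h1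
  simp only [hg.2.2.1] at h1
  rw [T_polar, hx] at h1
  have h48 : (48 : F) ≠ 0 := by
    have : (48 : F) = 2 ^ 4 * 3 := by norm_num
    rw [this]; positivity
  have h0 : symp F 0 w = 0 := by simp [symp, tb]
  rw [h0, mul_zero] at h1
  simpa [h48] using h1.symm

theorem intr_of_rank (x : FM F) (hx : RankLeOne F x) : Intr x := by
  obtain ⟨a, b, A, B⟩ := x
  obtain ⟨e1, e2, e3⟩ := hx
  simp only at e1 e2 e3
  have ht : tb F A B = 3 * (a * b) := by
    have := congrArg Matrix.trace (e3 1)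
    simp only [Matrix.trace_add, Matrix.trace_smul, Matrix.mul_one, Matrix.one_mul,
      Matrix.trace_one, Matrix.trace_mul_comm B A, Matrix.trace_zero] at this
    simp only [tb] at *
    simp at this
    linear_combination -this
  rintro ⟨c, d, C, D⟩
  have h := intr_polar a b c d A B C D
  rw [e1, e2] at h
  have e4 : ((8 * (tb F A B + a * b)) • C - (16 : F) • (A * B * C + C * B * A)) = 0 := by
    have := e3 C
    rw [ht] at *
    have h5 : A * B * C + C * B * A = (2 * (a * b)) • C := by
      rw [← sub_eq_zero, ← this]; module
    rw [h5]; module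
  rw [e4, ht] at h
  simp [tb] at h
  simp only [tb] at *
  linear_combination h

theorem tb_zero_right {X : Mat F} (h : ∀ Y, tb F Y X = 0) : X = 0 := by
  ext i j
  have := h (Matrix.single j i 1)
  fin_cases i <;> fin_cases j <;> simpa [tb_eq] using this

theorem rank_of_intr (h2 : (2 : F) ≠ 0) (x : FM F) (hx : Intr x) : RankLeOne F x := by
  obtain ⟨a, b, A, B⟩ := x
  have h : ∀ c d C D, _ = (0:F) := fun c d C D =>
    (intr_polar a b c d A B C D).symm.trans (by rw [hx]; ring)
  have h16 : (16 : F) ≠ 0 := by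
    have : (16 : F) = 2 ^ 4 := by norm_num
    rw [this]; positivity
  have h8 : (8 : F) ≠ 0 := by
    have : (8 : F) = 2 ^ 3 := by norm_num
    rw [this]; positivity
  have z1 : ∀ X : Mat F, tb F 0 X = 0 := by intro X; simp [tb]
  have z2 : ∀ X : Mat F, tb F X 0 = 0 := by intro X; simp [tb]
  have a0 : (0 : Mat F).adjugate = 0 := by simp
  have ht : tb F A B = 3 * (a * b) := by
    have := h 1 1 0 0
    simp [a0, z1, z2, h8] at this
    linear_combination this
  have e1 : a • A - B.adjugate = 0 := by
    apply tb_zero_right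
    intro D
    have p1 := h 0 1 0 D
    have p2 := h 0 0 0 D
    simp only [a0, z1, z2, mul_zero, zero_mul, Matrix.zero_mul, smul_zero, add_zero, sub_zero,
      sub_self, zero_add, zero_sub] at p1 p2
    rw [p2] at p1
    rw [tb_comm]
    simpa [h16] using p1
  have e2 : b • B - A.adjugate = 0 := by
    apply tb_zero_right
    intro C
    have p1 := h 1 0 C 0
    have p2 := h 0 0 C 0
    simp only [a0, z1, z2, mul_zero, zero_mul, Matrix.zero_mul, smul_zero, add_zero, sub_zero,
      sub_self, zero_add, zero_sub] at p1 p2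
    rw [p2] at p1
    rw [tb_comm]
    simpa [h16] using p1
  refine ⟨e1, e2, fun C => ?_⟩
  simp only
  have e3 : ((8 * (tb F A B + a * b)) • C - (16 : F) • (A * B * C + C * B * A)) = 0 := by
    apply tb_zero_right
    intro D
    have p := h 0 0 C D
    rw [e1, e2] at p
    simpa [z1, z2] using p
  rw [ht] at e3 ⊢
  have : (16 : F) • ((a * b - 3 * (a * b)) • C + A * B * C + C * B * A) = 0 := by
    rw [← neg_zero, ← e3]; module
  exact (smul_eq_zero.1 this).resolve_left h16

theorem orb_psi (b : F) (A B : Mat F) :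
    Orb (1, b, A, B) (1, b - tb F A B + 2 * B.det, A - B.adjugate, 0) := by
  have h1 := orb_swap 1 b A B
  have h2 := orb_phi B (-b) 1 (-B) A
  have h3 := orb_swap 1 (b - tb F A B + 2 * B.det) (A - B.adjugate) 0
  refine (h1.trans h2).trans (Eq.subst (motive := fun z => Orb z _) ?_ h3.symm)
  simp only [Prod.mk.injEq]
  refine ⟨?_, trivial, ?_, ?_⟩
  · simp only [tb_eq, Matrix.adjugate_fin_three, Matrix.det_fin_three]
    simp
    ring
  · simp
  · rw [cross_eq, Matrix.adjugate_fin_three]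
    ext i j
    fin_cases i <;> fin_cases j <;> simp <;> ring

theorem orb_scale (a b : F) (ha : a ≠ 0) (A B : Mat F) :
    ∃ b' A' B', Orb (a, b, A, B) (1, b', A', B') := by
  have h := orb_levi (Matrix.diagonal ![a, 1, 1]) (Matrix.diagonal ![a⁻¹, 1, 1]) 1 1 a a⁻¹
    (by
      rw [Matrix.diagonal_mul_diagonal, ← Matrix.diagonal_one]
      congr 1; ext i; fin_cases i <;> simp [ha])
    (by simp) (by simp [Matrix.det_diagonal, Fin.prod_univ_three]) (by simp [ha]) a b A B
  rw [inv_mul_cancel₀ ha] at h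
  exact ⟨_, _, _, h⟩

theorem orb_normal0 (a b : F) (ha : a ≠ 0) (A B : Mat F) :
    ∃ b' A', Orb (a, b, A, B) (1, b', A', 0) := by
  obtain ⟨b', A', B', h⟩ := orb_scale a b ha A B
  exact ⟨_, _, h.trans (orb_psi b' A' B')⟩

theorem orb_normal1 (h2 : (2 : F) ≠ 0) (A B : Mat F) (hB : B ≠ 0) :
    ∃ b' A', Orb (0, 0, A, B) (1, b', A', 0) := by
  have hC : ∃ C, tb F B C ≠ 0 := by
    by_contra hc
    push Not at hc
    exact hB (tb_zero_right fun Y => by rw [tb_comm]; exact hc Y)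
  obtain ⟨C, hC⟩ := hC
  by_cases h : tb F B C + tb F A C.adjugate = 0
  · have h1 := orb_phi (-C) 0 0 A B
    have hn : (0 + tb F B (-C) + tb F A (-C).adjugate + 0 * (-C).det) ≠ 0 := by
      have : (0 + tb F B (-C) + tb F A (-C).adjugate + 0 * (-C).det)
          = -2 * tb F B C + (tb F B C + tb F A C.adjugate) := by
        simp only [tb_eq, Matrix.adjugate_fin_three, Matrix.det_fin_three]
        simp
        ring
      rw [this, h]
      simp [h2, hC]
    obtain ⟨b', A', h3⟩ := orb_normal0 _ _ hn _ _
    exact ⟨_, _, h1.trans h3⟩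
  · have h1 := orb_phi C 0 0 A B
    obtain ⟨b', A', h3⟩ := orb_normal0 (0 + tb F B C + tb F A C.adjugate + 0 * C.det) 0
      (by simpa using h) (A + (0:F) • C) (B + cross F A C + (0:F) • C.adjugate)
    exact ⟨_, _, h1.trans h3⟩

theorem orb_normal (h2 : (2 : F) ≠ 0) (x : FM F) (hx : x ≠ 0) :
    ∃ b' A', Orb x (1, b', A', 0) := by
  obtain ⟨a, b, A, B⟩ := x
  by_cases ha : a = 0
  · have hs := orb_swap a b A B
    by_cases hb : b = 0
    · subst ha hb
      by_cases hB : B = 0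
      · have hA : A ≠ 0 := by
          rintro rfl; subst hB; exact hx rfl
        rw [neg_zero] at hs
        obtain ⟨b', A', h3⟩ := orb_normal1 h2 (-B) A hA
        exact ⟨_, _, hs.trans h3⟩
      · exact orb_normal1 h2 A B hB
    · obtain ⟨b', A', h3⟩ := orb_normal0 (-b) a (neg_ne_zero.2 hb) (-B) A
      exact ⟨_, _, hs.trans h3⟩
  · exact orb_normal0 a b ha A B

/-- Levi element of determinant one acting on `(1, b, A, 0)`. -/
theorem orb_levi1 (P Q : Mat F) (h : P.det * Q.det = 1) (b : F) (A : Mat F) :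
    Orb (1, b, A, 0) (1, b, P * A * Q, 0) := by
  have hP : IsUnit P.det := IsUnit.of_mul_eq_one _ h
  have hQ : IsUnit Q.det := IsUnit.of_mul_eq_one _ (by rw [mul_comm]; exact h)
  have := orb_levi P P⁻¹ Q Q⁻¹ 1 1 (Matrix.mul_nonsing_inv P hP) (Matrix.mul_nonsing_inv Q hQ)
    h (by simp) 1 b A 0
  simpa using this

theorem orb_diag (b : F) (A : Mat F) : ∃ D : Fin 3 → F, Orb (1, b, A, 0) (1, b, Matrix.diagonal D, 0) := by
  obtain ⟨L, L', D, h⟩ := Matrix.Pivot.exists_list_transvec_mul_mul_list_transvec_eq_diagonal A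
  refine ⟨D, ?_⟩
  rw [← h]
  apply orb_levi1
  simp

/-- permute and scale a diagonal matrix: generic monomial move -/
theorem orb_perm (σ : Equiv.Perm (Fin 3)) (b : F) (D : Fin 3 → F) :
    Orb (1, b, Matrix.diagonal D, 0) (1, b, Matrix.diagonal (D ∘ σ), 0) := by
  have h := orb_levi1 (σ.permMatrix F) ((σ⁻¹).permMatrix F) (by
    rw [Matrix.det_permutation, Matrix.det_permutation, Equiv.Perm.sign_inv, ← Int.cast_mul,
      Int.units_coe_mul_self, Int.cast_one]) b (Matrix.diagonal D)
  refine Eq.subst (motive := fun z => Orb _ (1, b, z, 0)) ?_ h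
  ext i j
  simp [Equiv.Perm.permMatrix, PEquiv.toMatrix_toPEquiv_mul, PEquiv.mul_toMatrix_toPEquiv, Matrix.submatrix_apply, Matrix.diagonal_apply]
  rw [show Equiv.symm σ⁻¹ = σ from rfl]
  simp

theorem orb_diag_scale (b u v w : F) (p q r : F) (h : p * q * r = 1) :
    Orb (1, b, Matrix.diagonal ![u, v, w], 0) (1, b, Matrix.diagonal ![p * u, q * v, r * w], 0) := by
  have h := orb_levi1 (Matrix.diagonal ![p, q, r]) 1 (by
    simp [Matrix.det_diagonal, Fin.prod_univ_three, h]) b (Matrix.diagonal ![u, v, w])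
  refine Eq.subst (motive := fun z => Orb _ (1, b, z, 0)) ?_ h
  rw [Matrix.mul_one, Matrix.diagonal_mul_diagonal]
  congr 1; ext i; fin_cases i <;> simp

theorem orb_rot (b u v w : F) :
    Orb (1, b, Matrix.diagonal ![u, v, w], 0) (1, b, Matrix.diagonal ![v, w, u], 0) := by
  refine Eq.subst (motive := fun z => Orb _ (1, b, Matrix.diagonal z, 0)) ?_
    (orb_perm (finRotate 3) b ![u, v, w])
  ext i; fin_cases i <;> rfl

theorem final_two (u : F) (hu : u ≠ 0) :
    Orb (1, 0, Matrix.diagonal ![u, 0, 0], 0) ((1, 0, Matrix.diagonal ![1, 0, 0], 0) : FM F) := by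
  simpa [hu] using orb_diag_scale 0 u 0 0 u⁻¹ u 1 (by simp [hu])

theorem final_three (u v : F) (hu : u ≠ 0) (hv : v ≠ 0) :
    Orb (1, 0, Matrix.diagonal ![u, v, 0], 0) ((1, 0, Matrix.diagonal ![1, 1, 0], 0) : FM F) := by
  simpa [hu, hv] using orb_diag_scale 0 u v 0 u⁻¹ v⁻¹ (u * v) (by field_simp)

theorem vec3 (D : Fin 3 → F) : D = ![D 0, D 1, D 2] := by
  ext i; fin_cases i <;> rfl

theorem adj_diag (u v w : F) : (Matrix.diagonal ![u, v, w]).adjugate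
    = Matrix.diagonal ![v * w, u * w, u * v] := by
  rw [Matrix.adjugate_fin_three]
  ext i j; fin_cases i <;> fin_cases j <;> simp

theorem T_normal (b : F) (A : Mat F) : Tcube F (1, b, A, 0)
    = (-b, b ^ 2 + 2 * A.det, b • A, (2 : F) • A.adjugate) := by
  simp only [Tcube, cross_eq, tb_eq, Matrix.det_fin_three, Matrix.adjugate_fin_three]
  ext i j
  · simp
  · simp
  · fin_cases i <;> fin_cases j <;> simp
  · fin_cases i <;> fin_cases j <;> simp

theorem q_normal (b : F) (A : Mat F) : qf F (1, b, A, 0) = -8 * A.det - 2 * b ^ 2 := by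
  simp [qf, tb]

theorem rank_two (h2 : (2 : F) ≠ 0) (h3 : (3 : F) ≠ 0) (x : FM F) (hx : RankTwo F x) :
    Orb x (1, 0, Matrix.diagonal ![1, 0, 0], 0) := by
  have hx0 : x ≠ 0 := by
    rintro rfl
    exact hx.2 ⟨by simp, by simp, by simp [tb]⟩
  obtain ⟨b, A, h⟩ := orb_normal h2 x hx0
  obtain ⟨D, h'⟩ := orb_diag b A
  have h := h.trans h'
  rw [vec3 D] at h
  generalize D 0 = u at *
  generalize D 1 = v at *
  generalize D 2 = w at *
  have hT := h.Tcube_zero h2 h3 hx.1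
  rw [T_normal, adj_diag] at hT
  simp only [Prod.mk_eq_zero, smul_eq_zero, h2, false_or, neg_eq_zero] at hT
  obtain ⟨rfl, -, -, hT⟩ := hT
  have t0 := congrFun (congrFun hT 0) 0
  have t1 := congrFun (congrFun hT 1) 1
  have t2 := congrFun (congrFun hT 2) 2
  simp at t0 t1 t2
  by_cases hu : u = 0
  · by_cases hv : v = 0
    · by_cases hw : w = 0
      · exfalso
        apply hx.2
        apply rank_of_intr h2
        apply h.symm.intr
        apply intr_of_rank
        subst hu hv hw
        have : Matrix.diagonal ![(0:F), 0, 0] = 0 := by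
          ext i j; fin_cases i <;> fin_cases j <;> simp
        rw [this]
        exact ⟨by simp, by simp, by simp [tb]⟩
      · subst hu hv
        exact ((h.trans (orb_rot _ _ _ _)).trans (orb_rot _ _ _ _)).trans (final_two w hw)
    · have hw : w = 0 := by simpa [hv] using t0
      subst hu hw
      exact (h.trans (orb_rot _ _ _ _)).trans (final_two v hv)
  · have hv : v = 0 := by simpa [hu] using t2
    have hw : w = 0 := by simpa [hu] using t1
    subst hv hw
    exact h.trans (final_two u hu)

theorem rank_one (h2 : (2 : F) ≠ 0) (x : FM F) (hx : RankOne F x) :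
    Orb x (1, 0, 0, 0) := by
  obtain ⟨b, A, h⟩ := orb_normal h2 x hx.1
  obtain ⟨e1, e2, e3⟩ := rank_of_intr h2 _ (h.intr (intr_of_rank x hx.2))
  simp at e1
  subst e1
  have := congrFun (congrFun (e3 1) 0) 0
  simp [tb] at this
  subst this
  exact h

theorem half_move (h2 : (2 : F) ≠ 0) (b : F) :
    Orb (1, b, Matrix.diagonal ![1, 1, - (b ^ 2 / 4)], 0)
      ((1, 0, Matrix.diagonal ![1, 1, 0], 0) : FM F) := by
  have h4 : (4 : F) ≠ 0 := by
    have : (4 : F) = 2 ^ 2 := by norm_num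
    rw [this]; positivity
  have h := orb_phi (Matrix.diagonal ![0, 0, b / 2]) 1 b (Matrix.diagonal ![1, 1, - (b ^ 2 / 4)]) 0
  have h' := orb_psi b (Matrix.diagonal ![1, 1, b ^ 2 / 4]) (Matrix.diagonal ![b / 2, b / 2, 0])
  have e : ((1 + tb F 0 (Matrix.diagonal ![0, 0, b / 2])
      + tb F (Matrix.diagonal ![1, 1, - (b ^ 2 / 4)]) (Matrix.diagonal ![0, 0, b / 2]).adjugate
      + b * (Matrix.diagonal ![0, 0, b / 2]).det, b, Matrix.diagonal ![1, 1, - (b ^ 2 / 4)]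
        + b • Matrix.diagonal ![0, 0, b / 2],
      0 + cross F (Matrix.diagonal ![1, 1, - (b ^ 2 / 4)]) (Matrix.diagonal ![0, 0, b / 2])
        + b • (Matrix.diagonal ![0, 0, b / 2]).adjugate) : FM F)
      = (1, b, Matrix.diagonal ![1, 1, b ^ 2 / 4], Matrix.diagonal ![b / 2, b / 2, 0]) := by
    simp only [adj_diag, Prod.mk.injEq]
    refine ⟨?_, trivial, ?_, ?_⟩
    · simp [tb_eq, Matrix.det_diagonal, Fin.prod_univ_three]
    · ext i j; fin_cases i <;> fin_cases j <;> simp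
      field_simp; ring
    · rw [cross_eq]
      ext i j; fin_cases i <;> fin_cases j <;> simp
  have e' : ((1, b - tb F (Matrix.diagonal ![1, 1, b ^ 2 / 4]) (Matrix.diagonal ![b / 2, b / 2, 0])
      + 2 * (Matrix.diagonal ![b / 2, b / 2, 0]).det, Matrix.diagonal ![1, 1, b ^ 2 / 4]
        - (Matrix.diagonal ![b / 2, b / 2, 0]).adjugate, 0) : FM F)
      = (1, 0, Matrix.diagonal ![1, 1, 0], 0) := by
    simp only [adj_diag, Prod.mk.injEq]
    refine ⟨trivial, ?_, ?_, trivial⟩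
    · simp [tb_eq, Matrix.det_diagonal, Fin.prod_univ_three]
      field_simp; ring
    · ext i j; fin_cases i <;> fin_cases j <;> simp
      field_simp; ring
  rw [e] at h
  rw [e'] at h'
  exact h.trans h'

theorem rank_three (h2 : (2 : F) ≠ 0) (h3 : (3 : F) ≠ 0) (x : FM F) (hx : RankThree F x) :
    Orb x (1, 0, Matrix.diagonal ![1, 1, 0], 0) := by
  have hx0 : x ≠ 0 := by
    rintro rfl
    apply hx.2
    simp [Tcube, tb, cross]
  have h4 : (4 : F) ≠ 0 := by
    have : (4 : F) = 2 ^ 2 := by norm_num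
    rw [this]; positivity
  obtain ⟨b, A, h⟩ := orb_normal h2 x hx0
  obtain ⟨D, h'⟩ := orb_diag b A
  have h := h.trans h'
  rw [vec3 D] at h
  generalize D 0 = u at *
  generalize D 1 = v at *
  generalize D 2 = w at *
  have hq := h.qf_eq
  rw [hx.1, q_normal] at hq
  have hdet : (Matrix.diagonal ![u, v, w]).det = u * v * w := by
    simp [Matrix.det_diagonal, Fin.prod_univ_three]
  rw [hdet] at hq
  have hd : u * v * w = -(b ^ 2 / 4) := by
    field_simp
    apply mul_left_cancel₀ h2
    linear_combination -hq
  by_cases hb : b = 0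
  · subst hb
    have hT : Tcube F (1, 0, Matrix.diagonal ![u, v, w], 0) ≠ 0 := fun h0 =>
      hx.2 (h.symm.Tcube_zero h2 h3 h0)
    rw [T_normal, adj_diag, hdet, hd] at hT
    by_cases hu : u = 0
    · subst hu
      by_cases hv : v = 0
      · subst hv
        exfalso; apply hT
        ext i j
        · simp
        · simp
        · simp
        · fin_cases i <;> fin_cases j <;> simp
      by_cases hw : w = 0
      · subst hw
        exfalso; apply hT
        ext i j
        · simp
        · simp
        · simp
        · fin_cases i <;> fin_cases j <;> simp
      exact (h.trans (orb_rot _ _ _ _)).trans (final_three v w hv hw)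
    · by_cases hv : v = 0
      · subst hv
        by_cases hw : w = 0
        · subst hw
          exfalso; apply hT
          ext i j
          · simp
          · simp
          · simp
          · fin_cases i <;> fin_cases j <;> simp
        exact ((h.trans (orb_rot _ _ _ _)).trans (orb_rot _ _ _ _)).trans (final_three w u hw hu)
      · have hw : w = 0 := by simpa [hu, hv] using hd
        subst hw
        exact h.trans (final_three u v hu hv)
  · have hne : u * v * w ≠ 0 := by
      rw [hd]; simp [hb, h4]
    have hu : u ≠ 0 := by rintro rfl; simp at hne
    have hv : v ≠ 0 := by rintro rfl; simp at hne
    have hs := orb_diag_scale b u v w u⁻¹ v⁻¹ (u * v) (by field_simp)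
    rw [inv_mul_cancel₀ hu, inv_mul_cancel₀ hv, hd] at hs
    exact (h.trans hs).trans (half_move h2 b)

end Freudenthal
open Freudenthal

/-- **Canonical forms for elements of rank 1, 2, 3** in `M = F ⊕ F ⊕ M₃(F) ⊕ M₃(F)`
(char `F ≠ 2, 3`): an element of rank `1`, `2`, `3` can be brought by `G(M)` to
`(1,0,0,0)`, `(1,0,diag(1,0,0),0)`, `(1,0,diag(1,1,0),0)` respectively. In particular
`G(M)` acts transitively on elements of each of these ranks. -/
theorem rank_orbits_field (F : Type*) [Field F] (h2 : (2 : F) ≠ 0) (h3 : (3 : F) ≠ 0) :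
    (∀ x : FM F, RankOne F x →
      ∃ g : FM F → FM F, InG F g ∧ g x = (1, 0, 0, 0)) ∧
    (∀ x : FM F, RankTwo F x →
      ∃ g : FM F → FM F, InG F g ∧ g x = (1, 0, Matrix.diagonal ![1, 0, 0], 0)) ∧
    (∀ x : FM F, RankThree F x →
      ∃ g : FM F → FM F, InG F g ∧ g x = (1, 0, Matrix.diagonal ![1, 1, 0], 0)) ∧
    (∀ x y : FM F, RankOne F x → RankOne F y →
      ∃ g : FM F → FM F, InG F g ∧ g x = y) ∧
    (∀ x y : FM F, RankTwo F x → RankTwo F y →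
      ∃ g : FM F → FM F, InG F g ∧ g x = y) ∧
    (∀ x y : FM F, RankThree F x → RankThree F y →
      ∃ g : FM F → FM F, InG F g ∧ g x = y) := by
  refine ⟨fun x hx => rank_one h2 x hx, fun x hx => rank_two h2 h3 x hx,
    fun x hx => rank_three h2 h3 x hx,
    fun x y hx hy => (rank_one h2 x hx).trans (rank_one h2 y hy).symm,
    fun x y hx hy => (rank_two h2 h3 x hx).trans (rank_two h2 h3 y hy).symm,
    fun x y hx hy => (rank_three h2 h3 x hx).trans (rank_three h2 h3 y hy).symm⟩
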